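/- arXiv:1203.4107 — 2 statements merged into one kernel-verified Lean document; each statement's English description precedes it below -/
import Mathlib

section
/- Let n = pq with p and q distinct odd primes. Then E(n) = 2^{(p−3)/2} + (2^{p−1} + p − 1)/(2p) + 2^{(q−3)/2} + (2^{q−1} + q − 1)/(2q) − 1, where both displayed fractions are integers. -/
open Polynomial

/-- The nonzero coefficients of `F`, read in order of increasing degree, alternate in sign:
any two nonzero coefficients with only zero coefficients strictly between them have
opposite signs. -/
def AltSigns (F : Polynomial ℤ) : Prop :=
  ∀ i j : ℕ, i < j → F.coeff i ≠ 0 → F.coeff j ≠ 0 →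
    (∀ k, i < k → k < j → F.coeff k = 0) → F.coeff j = -F.coeff i

/-- `F` is a Reinhardt polynomial for `n`: `F(0) = 1`, `deg F < n`, every coefficient lies
in `{-1, 0, 1}`, the nonzero coefficients read in order of increasing degree alternate in
sign beginning and ending with `+1` (so their number is odd), and `Φ_{2n} ∣ F`. -/
def IsReinhardt (n : ℕ) (F : Polynomial ℤ) : Prop :=
  F.coeff 0 = 1 ∧
  F.degree < (n : WithBot ℕ) ∧
  (∀ k, F.coeff k ∈ ({-1, 0, 1} : Set ℤ)) ∧
  AltSigns F ∧
  (∀ i, F.coeff i ≠ 0 → (∀ k, k < i → F.coeff k = 0) → F.coeff i = 1) ∧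
  (∀ i, F.coeff i ≠ 0 → (∀ k, i < k → F.coeff k = 0) → F.coeff i = 1) ∧
  Odd F.support.card ∧
  cyclotomic (2 * n) ℤ ∣ F

/-- The doubled coefficient sequence `u_F : ℤ/2nℤ → ℤ`: `u_F(k)` is the coefficient of
`z^k` in `F` for `0 ≤ k < n`, and `u_F(n + k) = -u_F(k)` for `0 ≤ k < n`. -/
def uF (n : ℕ) (F : Polynomial ℤ) (k : ZMod (2 * n)) : ℤ :=
  if k.val < n then F.coeff k.val else -F.coeff (k.val - n)

/-- `F` is `m`-antiperiodic: `u_F(k + m) = -u_F(k)` for all `k ∈ ℤ/2nℤ`. -/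
def Antiper (n : ℕ) (F : Polynomial ℤ) (m : ℕ) : Prop :=
  ∀ k : ZMod (2 * n), uF n F (k + (m : ZMod (2 * n))) = -uF n F k

/-- `F` is periodic: it is `(n/d)`-antiperiodic for some odd divisor `d > 1` of `n`. -/
def IsPeriodicR (n : ℕ) (F : Polynomial ℤ) : Prop :=
  ∃ d : ℕ, d ∣ n ∧ Odd d ∧ 1 < d ∧ Antiper n F (n / d)

/-- Dihedral equivalence of Reinhardt polynomials for `n`: `F'` is obtained from `F` by a
rotation `k ↦ k + c` or a reflection `k ↦ c - k` of the doubled coefficient sequence. -/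
def REquiv (n : ℕ) (F F' : Polynomial ℤ) : Prop :=
  ∃ c : ZMod (2 * n),
    (∀ k, uF n F' k = uF n F (k + c)) ∨ (∀ k, uF n F' k = uF n F (c - k))

/-- `E(n)`: the number of equivalence classes of Reinhardt polynomials for `n`. -/
noncomputable def En (n : ℕ) : ℕ :=
  Nat.card (Quot fun F F' : {F : Polynomial ℤ // IsReinhardt n F} => REquiv n F.1 F'.1)

/-- `E₁(n)`: the number of equivalence classes of Reinhardt polynomials for `n` all of whose
members are sporadic (i.e. not periodic). -/
noncomputable def E1 (n : ℕ) : ℕ :=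
  Nat.card {C : Quot fun F F' : {F : Polynomial ℤ // IsReinhardt n F} => REquiv n F.1 F'.1 //
    ∀ F, Quot.mk _ F = C → ¬IsPeriodicR n F.1}

theorem Nat.Prime.two_mul_dvd_two_pow_add_sub_one {p : ℕ} (hp : p.Prime) (hop : Odd p) :
    2 * p ∣ 2 ^ (p - 1) + p - 1 := by
  have h2 := hp.two_le
  have hp3 : 3 ≤ p := by
    obtain ⟨m, rfl⟩ := hop
    omega
  refine Nat.Coprime.mul_dvd_of_dvd_of_dvd ?_ ?_ ?_
  · exact (Nat.coprime_two_left).2 hop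
  · rw [Nat.add_sub_assoc (by omega)]
    exact dvd_add (dvd_pow_self 2 (by omega)) (hop.tsub_odd odd_one).two_dvd
  · have hc : Nat.Coprime 2 p := Nat.coprime_two_left.2 hop
    have := Nat.ModEq.pow_totient hc
    rw [Nat.totient_prime hp] at this
    have h1 : p ∣ 2 ^ (p - 1) - 1 :=
      (Nat.modEq_iff_dvd' Nat.one_le_two_pow).1 this.symm
    rw [show 2 ^ (p - 1) + p - 1 = (2 ^ (p - 1) - 1) + p by
      have := Nat.one_le_two_pow (n := p - 1); omega]
    exact dvd_add h1 dvd_rfl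

open DihedralGroup in
/-- Dihedral symmetries act on sign functions on `ℤ/nℤ` by precomposition, and signs by
multiplication. -/
instance signFunctionAction (n : ℕ) : MulAction (DihedralGroup n × ℤˣ) (ZMod n → ℤˣ) where
  smul g t := match g with
    | (r i, ε) => fun k => ε * t (k + i)
    | (sr i, ε) => fun k => ε * t (i - k)
  one_smul t := by
    funext k
    change 1 * t (k + 0) = t k
    simp
  mul_smul := by
    rintro ⟨i | i, ε⟩ ⟨j | j, δ⟩ t <;> funext k
    · change ε * δ * t (k + (i + j)) = ε * (δ * t (k + i + j))
      rw [mul_assoc, add_assoc]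
    · change ε * δ * t (j - i - k) = ε * (δ * t (j - (k + i)))
      rw [mul_assoc]; congr 3; ring
    · change ε * δ * t (i + j - k) = ε * (δ * t (i - k + j))
      rw [mul_assoc]; congr 3; ring
    · change ε * δ * t (k + (j - i)) = ε * (δ * t (j - (i - k)))
      rw [mul_assoc]; congr 3; ring

/-- Sign functions on `ℤ/nℤ` up to rotation, reflection and global sign change. -/
abbrev SignBracelet (n : ℕ) : Type :=
  MulAction.orbitRel.Quotient (DihedralGroup n × ℤˣ) (ZMod n → ℤˣ)

namespace SignBracelet

/-- The bracelet of a sign function. -/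
def mk {n : ℕ} (t : ZMod n → ℤˣ) : SignBracelet n := Quotient.mk'' t

variable {n : ℕ}

theorem mk_surjective : Function.Surjective (mk (n := n)) := Quotient.mk''_surjective

theorem r_smul (i : ZMod n) (ε : ℤˣ) (t : ZMod n → ℤˣ) (k : ZMod n) :
    ((DihedralGroup.r i, ε) • t) k = ε * t (k + i) := rfl

theorem sr_smul (i : ZMod n) (ε : ℤˣ) (t : ZMod n → ℤˣ) (k : ZMod n) :
    ((DihedralGroup.sr i, ε) • t) k = ε * t (i - k) := rfl

theorem mk_eq_mk_iff {t t' : ZMod n → ℤˣ} :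
    mk t = mk t' ↔ ∃ (c : ZMod n) (ε : ℤˣ),
      (∀ k, t' k = ε * t (k + c)) ∨ (∀ k, t' k = ε * t (c - k)) := by
  rw [eq_comm, mk, mk, Quotient.eq'', MulAction.orbitRel_apply]
  constructor
  · rintro ⟨⟨c | c, ε⟩, rfl⟩
    · exact ⟨c, ε, Or.inl fun _ => rfl⟩
    · exact ⟨c, ε, Or.inr fun _ => rfl⟩
  · rintro ⟨c, ε, h | h⟩
    · exact ⟨(DihedralGroup.r c, ε), (funext h).symm⟩
    · exact ⟨(DihedralGroup.sr c, ε), (funext h).symm⟩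

theorem fixedBy_neg_one_eq_empty [NeZero n] (hn : Odd n) (g : DihedralGroup n) :
    MulAction.fixedBy (ZMod n → ℤˣ) (g, (-1 : ℤˣ)) = ∅ := by
  have key (σ : ZMod n ≃ ZMod n) (t : ZMod n → ℤˣ) : ¬ ∀ k, -1 * t (σ k) = t k := by
    intro h
    have h1 : ∏ k, t k = ∏ k, (-1 * t (σ k)) := Finset.prod_congr rfl fun k _ => (h k).symm
    rw [Finset.prod_mul_distrib, Equiv.prod_comp σ t, Finset.prod_const, Finset.card_univ,
      ZMod.card, hn.neg_one_pow] at h1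
    simp at h1
  refine Set.eq_empty_of_forall_notMem fun t ht => ?_
  rw [MulAction.mem_fixedBy] at ht
  rcases g with i | i
  · exact key (Equiv.addRight i) t fun k => congrFun ht k
  · exact key (Equiv.subLeft i) t fun k => congrFun ht k

theorem card_fixedBy_one [NeZero n] :
    Nat.card (MulAction.fixedBy (ZMod n → ℤˣ) ((.r 0, 1) : DihedralGroup n × ℤˣ)) = 2 ^ n := by
  have : MulAction.fixedBy (ZMod n → ℤˣ) ((.r 0, 1) : DihedralGroup n × ℤˣ) = Set.univ :=
    MulAction.fixedBy_one_eq_univ _ _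
  rw [this, Nat.card_univ]
  simp

theorem card_fixedBy_r [Fact n.Prime] {i : ZMod n} (hi : i ≠ 0) :
    Nat.card (MulAction.fixedBy (ZMod n → ℤˣ) ((.r i, 1) : DihedralGroup n × ℤˣ)) = 2 := by
  have : MulAction.fixedBy (ZMod n → ℤˣ) ((.r i, 1) : DihedralGroup n × ℤˣ)
      = Set.range (Function.const (ZMod n)) := by
    ext t
    rw [MulAction.mem_fixedBy]
    constructor
    · intro h
      have h1 (k : ZMod n) : t (k + i) = t k := by simpa [r_smul] using congrFun h k
      have h2 (m : ℕ) : t (m * i) = t 0 := by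
        induction m with
        | zero => simp
        | succ m ih => rw [← ih, ← h1 (m * i)]; congr 1; push_cast; ring
      refine ⟨t 0, funext fun k => ?_⟩
      have h3 := h2 (k * i⁻¹).val
      rw [ZMod.natCast_zmod_val, mul_assoc, inv_mul_cancel₀ hi, mul_one] at h3
      exact h3.symm
    · rintro ⟨ε, rfl⟩
      funext k
      simp [r_smul]
  rw [this, Nat.card_range_of_injective Function.const_injective]
  simp

theorem card_fixedBy_sr [Fact n.Prime] (hn : Odd n) (i : ZMod n) :
    Nat.card (MulAction.fixedBy (ZMod n → ℤˣ) ((.sr i, 1) : DihedralGroup n × ℤˣ))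
      = 2 ^ (n / 2 + 1) := by
  have h2 : (2 : ZMod n) ≠ 0 := by
    intro h
    have : n ∣ 2 := (ZMod.natCast_eq_zero_iff 2 n).1 (by exact_mod_cast h)
    have := (Nat.prime_dvd_prime_iff_eq Fact.out Nat.prime_two).1 this
    subst this
    exact absurd hn (by decide)
  obtain ⟨c, rfl⟩ : ∃ c, i = 2 * c := ⟨i / 2, by field_simp⟩
  have hfold (k : ZMod n) : (k - c).valMinAbs.natAbs < n / 2 + 1 :=
    Nat.lt_succ_of_le (ZMod.natAbs_valMinAbs_le _)
  let e : MulAction.fixedBy (ZMod n → ℤˣ) ((.sr (2 * c), 1) : DihedralGroup n × ℤˣ)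
      ≃ (Fin (n / 2 + 1) → ℤˣ) :=
    { toFun := fun t j => t.1 (c + (j : ℕ))
      invFun := fun f => ⟨fun k => f ⟨_, hfold k⟩, by
        rw [MulAction.mem_fixedBy]
        funext k
        rw [sr_smul, one_mul]
        congr 2
        rw [show 2 * c - k - c = -(k - c) by ring, ZMod.natAbs_valMinAbs_neg]⟩
      left_inv := by
        rintro ⟨t, ht⟩
        rw [MulAction.mem_fixedBy] at ht
        refine Subtype.ext (funext fun k => ?_)
        change t (c + (((k - c).valMinAbs.natAbs : ℕ) : ZMod n)) = t k
        rw [ZMod.natCast_natAbs_valMinAbs]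
        split_ifs
        · congr 1; ring
        · rw [← congrFun ht k, sr_smul, one_mul]; congr 1; ring
      right_inv := by
        intro f
        funext j
        change f _ = f j
        congr 1
        refine Fin.ext ?_
        change (c + ((j : ℕ) : ZMod n) - c).valMinAbs.natAbs = j
        rw [add_sub_cancel_left, ZMod.valMinAbs_natCast_of_le_half (by omega)]
        simp }
  rw [Nat.card_congr e]
  simp

/-- Burnside's lemma for bracelets of odd prime length. -/
theorem card_mul [Fact n.Prime] (hn : Odd n) :
    Nat.card (SignBracelet n) * (4 * n) = 2 ^ n + 2 * (n - 1) + n * 2 ^ (n / 2 + 1) := by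
  classical
  have hB := MulAction.sum_card_fixedBy_eq_card_orbits_mul_card_group
    (DihedralGroup n × ℤˣ) (ZMod n → ℤˣ)
  simp only [← Nat.card_eq_fintype_card] at hB
  change _ = Nat.card (SignBracelet n) * _ at hB
  have hr : ∑ i : ZMod n, Nat.card (MulAction.fixedBy (ZMod n → ℤˣ)
      ((.r i, 1) : DihedralGroup n × ℤˣ)) = 2 ^ n + 2 * (n - 1) := by
    rw [← Finset.add_sum_erase _ _ (Finset.mem_univ (0 : ZMod n)), card_fixedBy_one,
      Finset.sum_congr rfl fun i hi => card_fixedBy_r (Finset.ne_of_mem_erase hi)]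
    simp [Finset.card_erase_of_mem, ZMod.card, mul_comm]
  have hone : ∑ g : DihedralGroup n, Nat.card (MulAction.fixedBy (ZMod n → ℤˣ)
      ((g, 1) : DihedralGroup n × ℤˣ)) = 2 ^ n + 2 * (n - 1) + n * 2 ^ (n / 2 + 1) := by
    rw [← Equiv.sum_comp DihedralGroup.equivSum.symm, Fintype.sum_sum_type]
    refine congrArg₂ (· + ·) hr ((Finset.sum_congr rfl fun i _ => card_fixedBy_sr hn i).trans ?_)
    simp [ZMod.card]
  rw [Fintype.sum_prod_type_right, UnitsInt.univ, Finset.sum_pair (by decide), hone] at hB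
  simp only [fixedBy_neg_one_eq_empty hn] at hB
  rw [Nat.card_prod, DihedralGroup.nat_card] at hB
  simp only [Nat.card_of_isEmpty, Finset.sum_const_zero, add_zero, Nat.card_eq_fintype_card,
    Fintype.card_units_int] at hB
  rw [hB, Nat.card_eq_fintype_card]
  ring

theorem card_eq {p : ℕ} (hp : p.Prime) (hop : Odd p) :
    Nat.card (SignBracelet p) = 2 ^ ((p - 3) / 2) + (2 ^ (p - 1) + p - 1) / (2 * p) := by
  have := Fact.mk hp
  have h := card_mul (n := p) hop
  obtain ⟨x, hx⟩ := hp.two_mul_dvd_two_pow_add_sub_one hop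
  rw [hx, Nat.mul_div_cancel_left _ (by have := hp.pos; omega)]
  obtain ⟨m, rfl⟩ := hop
  obtain ⟨l, rfl⟩ : ∃ l, m = l + 1 := ⟨m - 1, by have := hp.two_le; omega⟩
  rw [show (2 * (l + 1) + 1) / 2 + 1 = l + 2 by omega] at h
  rw [show (2 * (l + 1) + 1 - 3) / 2 = l by omega]
  have h3 : 2 ^ (2 * (l + 1) + 1) + 2 * (2 * (l + 1) + 1 - 1)
      = 2 * (2 * (2 * (l + 1) + 1) * x) := by
    rw [← hx, show 2 * (l + 1) + 1 - 1 = 2 * (l + 1) by omega, pow_succ]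
    omega
  rw [h3] at h
  refine Nat.eq_of_mul_eq_mul_right (show 0 < 4 * (2 * (l + 1) + 1) by omega) (h.trans ?_)
  ring

/-- Pull back bracelets along the projection `ℤ/nℤ → ℤ/mℤ`. -/
def lift {m : ℕ} (h : m ∣ n) : SignBracelet m → SignBracelet n :=
  Quotient.lift (fun t => mk (t ∘ ZMod.castHom h (ZMod m))) (by
    intro t t' htt
    obtain ⟨c, ε, hc⟩ := mk_eq_mk_iff.1 (Quotient.sound htt : mk t = mk t')
    obtain ⟨d, rfl⟩ := ZMod.castHom_surjective h c
    refine mk_eq_mk_iff.2 ⟨d, ε, hc.imp (fun hc k => ?_) (fun hc k => ?_)⟩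
    · simp only [Function.comp_apply, hc, map_add]
    · simp only [Function.comp_apply, hc, map_sub])

theorem lift_mk {m : ℕ} (h : m ∣ n) (t : ZMod m → ℤˣ) :
    lift h (mk t) = mk (t ∘ ZMod.castHom h (ZMod m)) := rfl

theorem lift_injective {m : ℕ} (h : m ∣ n) : Function.Injective (lift h) := by
  intro a b hab
  obtain ⟨t, rfl⟩ := mk_surjective a
  obtain ⟨t', rfl⟩ := mk_surjective b
  obtain ⟨c, ε, hc⟩ := mk_eq_mk_iff.1 hab
  refine mk_eq_mk_iff.2 ⟨ZMod.castHom h (ZMod m) c, ε, hc.imp (fun hc k => ?_) (fun hc k => ?_)⟩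
  all_goals
    obtain ⟨l, rfl⟩ := ZMod.castHom_surjective h k
    simpa only [Function.comp_apply, map_add, map_sub] using hc l

theorem range_lift_inter_range_lift {p q : ℕ} (hpq : p.Coprime q) :
    Set.range (lift (dvd_mul_right p q)) ∩ Set.range (lift (dvd_mul_left q p)) =
      {mk fun _ => 1} := by
  have hcrt (x : ZMod p) (y : ZMod q) : ∃ k : ZMod (p * q),
      ZMod.castHom (dvd_mul_right p q) (ZMod p) k = x ∧
      ZMod.castHom (dvd_mul_left q p) (ZMod q) k = y := by
    obtain ⟨k, hk⟩ := (ZMod.chineseRemainder hpq).surjective (x, y)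
    refine ⟨k, ?_, ?_⟩
    · rw [← show (ZMod.chineseRemainder hpq k).1 = x from congrArg Prod.fst hk]
      exact DFunLike.congr_fun (Subsingleton.elim (ZMod.castHom (dvd_mul_right p q) (ZMod p))
        ((RingHom.fst _ _).comp (ZMod.chineseRemainder hpq).toRingHom)) k
    · rw [← show (ZMod.chineseRemainder hpq k).2 = y from congrArg Prod.snd hk]
      exact DFunLike.congr_fun (Subsingleton.elim (ZMod.castHom (dvd_mul_left q p) (ZMod q))
        ((RingHom.snd _ _).comp (ZMod.chineseRemainder hpq).toRingHom)) k
  ext B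
  constructor
  · rintro ⟨⟨a, rfl⟩, ⟨b, hb⟩⟩
    obtain ⟨t, rfl⟩ := mk_surjective a
    obtain ⟨s, rfl⟩ := mk_surjective b
    obtain ⟨c, ε, hc⟩ := mk_eq_mk_iff.1 hb
    rw [lift_mk, Set.mem_singleton_iff, eq_comm, mk_eq_mk_iff]
    refine ⟨0, t 0, Or.inl fun k => ?_⟩
    rcases hc with hc | hc
    · obtain ⟨l, hl1, hl2⟩ := hcrt (ZMod.castHom (dvd_mul_right p q) (ZMod p) k)
        (-ZMod.castHom (dvd_mul_left q p) (ZMod q) c)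
      obtain ⟨l', hl1', hl2'⟩ := hcrt 0 (-ZMod.castHom (dvd_mul_left q p) (ZMod q) c)
      have h1 := hc l
      have h2 := hc l'
      simp only [Function.comp_apply, map_add, hl1, hl2, hl1', hl2'] at h1 h2
      simp only [Function.comp_apply, h1, h2, mul_one]
    · obtain ⟨l, hl1, hl2⟩ := hcrt (ZMod.castHom (dvd_mul_right p q) (ZMod p) k) 0
      obtain ⟨l', hl1', hl2'⟩ := hcrt 0 0
      have h1 := hc l
      have h2 := hc l'
      simp only [Function.comp_apply, map_sub, hl1, hl2, hl1', hl2'] at h1 h2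
      simp only [Function.comp_apply, h1, h2, mul_one]
  · rintro rfl
    exact ⟨⟨mk fun _ => 1, rfl⟩, ⟨mk fun _ => 1, rfl⟩⟩

theorem ncard_range_lift_union_range_lift {p q : ℕ} [NeZero p] [NeZero q] (hpq : p.Coprime q) :
    (Set.range (lift (dvd_mul_right p q)) ∪ Set.range (lift (dvd_mul_left q p))).ncard + 1 =
      Nat.card (SignBracelet p) + Nat.card (SignBracelet q) := by
  have h := Set.ncard_union_add_ncard_inter (Set.range (lift (dvd_mul_right p q)))
    (Set.range (lift (dvd_mul_left q p)))
  rw [range_lift_inter_range_lift hpq, Set.ncard_singleton,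
    Set.ncard_range_of_injective (lift_injective _), Set.ncard_range_of_injective (lift_injective _)] at h
  exact h

end SignBracelet

/-- The sign function `t` on `ℤ/nℤ` encodes `F`: up to alternating signs, the doubled
coefficient sequence of `F` consists of the averages of consecutive values of `t`. -/
def Encodes (n : ℕ) (t : ZMod n → ℤˣ) (F : Polynomial ℤ) : Prop :=
  ∀ k : ℕ, 2 * uF n F (k : ZMod (2 * n)) =
    (-1) ^ (k + 1) * ((t (k : ZMod n) : ℤ) + (t ((k + 1 : ℕ) : ZMod n) : ℤ))

theorem uF_natCast_of_lt {n : ℕ} (F : Polynomial ℤ) {k : ℕ} (hk : k < n) :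
    uF n F (k : ZMod (2 * n)) = F.coeff k := by
  have hv : ((k : ZMod (2 * n))).val = k := ZMod.val_cast_of_lt (by omega)
  rw [uF, hv, if_pos hk]

theorem uF_natCast_add_of_lt {n : ℕ} (F : Polynomial ℤ) {k : ℕ} (hk : k < n) :
    uF n F ((n + k : ℕ) : ZMod (2 * n)) = -F.coeff k := by
  have hv : (((n + k : ℕ) : ZMod (2 * n))).val = n + k := ZMod.val_cast_of_lt (by omega)
  rw [uF, hv, if_neg (by omega), Nat.add_sub_cancel_left]

namespace Encodes

variable {n : ℕ} {t t' : ZMod n → ℤˣ} {F F' : Polynomial ℤ}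

theorem of_coeff (hn : Odd n)
    (h : ∀ k < n, 2 * F.coeff k =
      (-1) ^ (k + 1) * ((t (k : ZMod n) : ℤ) + (t ((k + 1 : ℕ) : ZMod n) : ℤ))) :
    Encodes n t F := by
  intro k
  have hpos := hn.pos
  obtain ⟨j, hj, m, rfl⟩ : ∃ j < 2 * n, ∃ m, k = j + 2 * n * m :=
    ⟨k % (2 * n), Nat.mod_lt _ (by omega), k / (2 * n), (Nat.mod_add_div _ _).symm⟩
  have e1 : ((j + 2 * n * m : ℕ) : ZMod (2 * n)) = j := by
    rw [Nat.cast_add, Nat.cast_mul (2 * n), ZMod.natCast_self, zero_mul, add_zero]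
  have e2 : ((j + 2 * n * m : ℕ) : ZMod n) = j := by simp
  have e3 : ((j + 2 * n * m + 1 : ℕ) : ZMod n) = (j + 1 : ℕ) := by simp
  have e4 : (-1 : ℤ) ^ (j + 2 * n * m + 1) = (-1) ^ (j + 1) := by
    rw [show j + 2 * n * m + 1 = j + 1 + 2 * (n * m) by ring, pow_add, pow_mul]; simp
  rw [e1, e2, e3, e4]
  rcases lt_or_ge j n with hjn | hjn
  · rw [uF_natCast_of_lt F hjn, h j hjn]
  · obtain ⟨i, rfl⟩ := Nat.exists_eq_add_of_le hjn
    rw [uF_natCast_add_of_lt F (by omega), mul_neg, h i (by omega)]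
    rw [show n + i + 1 = n + (i + 1) by ring, pow_add _ n, hn.neg_one_pow]
    simp

theorem coeff (h : Encodes n t F) {k : ℕ} (hk : k < n) : 2 * F.coeff k =
    (-1) ^ (k + 1) * ((t (k : ZMod n) : ℤ) + (t ((k + 1 : ℕ) : ZMod n) : ℤ)) := by
  rw [← h k, uF_natCast_of_lt F hk]

theorem unique (hn : Odd n) (h : Encodes n t F) (h' : Encodes n t' F) : t = t' := by
  have : NeZero n := ⟨hn.pos.ne'⟩
  have key (k : ℕ) : ((t k : ℤ) - t' k) = (-1) ^ k * ((t 0 : ℤ) - t' 0) := by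
    induction k with
    | zero => simp
    | succ k ih =>
      have h1 := (h k).symm.trans (h' k)
      have h2 := mul_left_cancel₀ (pow_ne_zero _ (by norm_num)) h1
      rw [pow_succ]
      linarith
  have h0 := key n
  rw [ZMod.natCast_self, hn.neg_one_pow] at h0
  funext x
  have hx := key x.val
  rw [ZMod.natCast_zmod_val, show (t 0 : ℤ) - t' 0 = 0 by linarith, mul_zero] at hx
  exact Units.ext (by linarith)

theorem uF_add (h : Encodes n t F) (c k : ℕ) :
    2 * uF n F ((k : ZMod (2 * n)) + c) =
      (-1) ^ (k + 1) * ((-1) ^ c * t ((k : ZMod n) + c) +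
        (-1) ^ c * t (((k + 1 : ℕ) : ZMod n) + c)) := by
  rw [← Nat.cast_add, h]
  push_cast
  rw [show ((k : ZMod n) + 1 + c) = k + c + 1 by ring]
  ring

theorem uF_sub [NeZero n] (h : Encodes n t F) (c k : ℕ) :
    2 * uF n F ((c : ZMod (2 * n)) - (k : ZMod (2 * n))) =
      (-1) ^ (k + 1) * ((-1) ^ c * t (((c : ZMod n) + 1) - k) +
        (-1) ^ c * t (((c : ZMod n) + 1) - (k + 1 : ℕ))) := by
  obtain ⟨m, hm⟩ := ZMod.natCast_zmod_surjective ((c : ZMod (2 * n)) - (k : ZMod (2 * n)))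
  have hmk : ((m + k : ℕ) : ZMod (2 * n)) = c := by rw [Nat.cast_add, hm]; ring
  have hmod := (ZMod.natCast_eq_natCast_iff _ _ _).1 hmk
  have hn' : ((m + k : ℕ) : ZMod n) = c :=
    (ZMod.natCast_eq_natCast_iff _ _ _).2 (hmod.of_mul_left 2)
  have hsign : (-1 : ℤ) ^ (m + k) = (-1) ^ c := by
    rw [neg_one_pow_eq_pow_mod_two, hmod.of_mul_right n, ← neg_one_pow_eq_pow_mod_two]
  rw [← hm, h]
  push_cast at hn' ⊢
  rw [← hn', show ((m : ZMod n) + k + 1 - k) = m + 1 by ring,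
    show ((m : ZMod n) + k + 1 - (k + 1)) = m by ring, ← hsign]
  have hk : ((-1 : ℤ) ^ k) * (-1) ^ k = 1 := by rw [← mul_pow]; simp
  linear_combination ((-1 : ℤ) ^ m * ((t (m : ZMod n) : ℤ) + t (m + 1))) * hk

theorem exists_of_equiv (hn : Odd n) (h : Encodes n t F) (hFF : REquiv n F F') :
    ∃ (c : ZMod n) (ε : ℤˣ), Encodes n (fun k => ε * t (k + c)) F' ∨
      Encodes n (fun k => ε * t (c - k)) F' := by
  have : NeZero n := ⟨hn.pos.ne'⟩
  obtain ⟨c, hc⟩ := hFF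
  obtain ⟨c, rfl⟩ := ZMod.natCast_zmod_surjective c
  rcases hc with hc | hc
  · refine ⟨c, (-1) ^ c, Or.inl fun k => ?_⟩
    rw [hc, h.uF_add]
    push_cast
    rfl
  · refine ⟨c + 1, (-1) ^ c, Or.inr fun k => ?_⟩
    rw [hc, h.uF_sub]
    push_cast
    rfl

theorem equiv_of_exists (hn : Odd n) (h : Encodes n t F) (h' : Encodes n t' F')
    {c : ZMod n} {ε : ℤˣ}
    (hc : (∀ k, t' k = ε * t (k + c)) ∨ (∀ k, t' k = ε * t (c - k))) : REquiv n F F' := by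
  have : NeZero n := ⟨hn.pos.ne'⟩
  have hlift (c : ZMod n) (ε : ℤˣ) : ∃ d : ℕ, (d : ZMod n) = c ∧ (-1) ^ d = ε := by
    by_cases hs : (-1) ^ c.val = ε
    · exact ⟨c.val, by simp, hs⟩
    · refine ⟨c.val + n, by simp, ?_⟩
      rw [pow_add, hn.neg_one_pow, Int.units_ne_iff_eq_neg.1 hs]
      simp
  rcases hc with hc | hc
  · obtain ⟨d, rfl, rfl⟩ := hlift c ε
    refine ⟨d, Or.inl fun k => ?_⟩
    obtain ⟨k, rfl⟩ := ZMod.natCast_zmod_surjective k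
    refine mul_left_cancel₀ two_ne_zero ?_
    rw [h.uF_add, h', hc, hc]
    push_cast
    rfl
  · obtain ⟨d, hd, hε⟩ := hlift (c - 1) ε
    obtain rfl : c = d + 1 := by rw [hd]; ring
    subst hε
    refine ⟨d, Or.inr fun k => ?_⟩
    obtain ⟨k, rfl⟩ := ZMod.natCast_zmod_surjective k
    refine mul_left_cancel₀ two_ne_zero ?_
    rw [h.uF_sub, h', hc, hc]
    push_cast
    rfl

theorem equiv_iff (hn : Odd n) (h : Encodes n t F) (h' : Encodes n t' F') :
    REquiv n F F' ↔ SignBracelet.mk t = SignBracelet.mk t' := by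
  rw [SignBracelet.mk_eq_mk_iff]
  constructor
  · intro hFF
    obtain ⟨c, ε, hc⟩ := h.exists_of_equiv hn hFF
    exact ⟨c, ε, hc.imp (fun hc k => congrFun (h'.unique hn hc) k)
      (fun hc k => congrFun (h'.unique hn hc) k)⟩
  · rintro ⟨c, ε, hc⟩
    exact h.equiv_of_exists hn h' hc

end Encodes

/-- The partial sums of an alternating sequence starting with `1` are `0` or `1`, according to
the sign of the last nonzero term. -/
theorem AltSigns.sum_range {F : Polynomial ℤ} (hF : AltSigns F) (h0 : F.coeff 0 = 1) (k : ℕ) :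
    (∑ i ∈ Finset.range (k + 1), F.coeff i = 1 ∧
      ∃ j ≤ k, F.coeff j = 1 ∧ ∀ i, j < i → i ≤ k → F.coeff i = 0) ∨
    (∑ i ∈ Finset.range (k + 1), F.coeff i = 0 ∧
      ∃ j ≤ k, F.coeff j = -1 ∧ ∀ i, j < i → i ≤ k → F.coeff i = 0) := by
  induction k with
  | zero => exact Or.inl ⟨by simpa using h0, 0, le_rfl, h0, fun i h1 h2 => by omega⟩
  | succ k ih =>
    rw [Finset.sum_range_succ]
    by_cases hz : F.coeff (k + 1) = 0
    · rw [hz, add_zero]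
      have hext (j : ℕ) (hj : ∀ i, j < i → i ≤ k → F.coeff i = 0) (i : ℕ) (h1 : j < i)
          (h2 : i ≤ k + 1) : F.coeff i = 0 := by
        rcases Nat.le_succ_iff.1 h2 with h3 | rfl
        · exact hj i h1 h3
        · exact hz
      rcases ih with ⟨hs, j, hjk, hj, hj'⟩ | ⟨hs, j, hjk, hj, hj'⟩
      · exact Or.inl ⟨hs, j, by omega, hj, hext j hj'⟩
      · exact Or.inr ⟨hs, j, by omega, hj, hext j hj'⟩
    · rcases ih with ⟨hs, j, hjk, hj, hj'⟩ | ⟨hs, j, hjk, hj, hj'⟩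
      all_goals
        have h1 := hF j (k + 1) (by omega) (by rw [hj]; decide) hz
          fun i h1 h2 => hj' i h1 (by omega)
        rw [hj] at h1
      · exact Or.inr ⟨by rw [hs, h1]; rfl, k + 1, le_rfl, h1, fun i h1 h2 => by omega⟩
      · exact Or.inl ⟨by rw [hs, h1]; rfl, k + 1, le_rfl, h1, fun i h1 h2 => by omega⟩

theorem IsReinhardt.sum_coeff {n : ℕ} {F : Polynomial ℤ} (hF : IsReinhardt n F) (hn : 0 < n) :
    ∑ i ∈ Finset.range n, F.coeff i = 1 := by
  obtain ⟨h0, hdeg, hc, halt, -, hlast, -⟩ := hF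
  obtain ⟨n, rfl⟩ : ∃ m, n = m + 1 := ⟨n - 1, by omega⟩
  rcases halt.sum_range h0 n with ⟨h, -⟩ | ⟨-, j, hjn, hj, hj'⟩
  · exact h
  · have := hlast j (by rw [hj]; decide) fun k hk => by
      rcases Nat.lt_or_ge k (n + 1) with h1 | h1
      · exact hj' k hk (by omega)
      · exact coeff_eq_zero_of_degree_lt (hdeg.trans_le (by exact_mod_cast h1))
    rw [hj] at this
    exact absurd this (by decide)

theorem IsReinhardt.exists_encodes {n : ℕ} {F : Polynomial ℤ} (hF : IsReinhardt n F)
    (hn : Odd n) : ∃ t : ZMod n → ℤˣ, Encodes n t F := by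
  classical
  have : NeZero n := ⟨hn.pos.ne'⟩
  let P (k : ℕ) : ℤ := ∑ i ∈ Finset.range k, F.coeff i
  let s (k : ℕ) : ℤˣ := if P k = 0 then -1 else 1
  have hs (k : ℕ) : (s k : ℤ) = 2 * P k - 1 := by
    have hP : P k = 0 ∨ P k = 1 := by
      rcases k with - | k
      · left; simp [P]
      · exact (hF.2.2.2.1.sum_range hF.1 k).symm.imp And.left And.left
    rcases hP with h | h <;> simp [s, h]
  let t (x : ZMod n) : ℤˣ := (-1) ^ x.val * s x.val
  have ht (k : ℕ) (hk : k ≤ n) : (t k : ℤ) = (-1) ^ k * (2 * P k - 1) := by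
    rw [← hs]
    rcases hk.lt_or_eq with hk | rfl
    · simp [t, ZMod.val_cast_of_lt hk]
    · have h0 : s 0 = -1 := by simp [s, P]
      have h1 : s k = 1 := by simp [s, P, hF.sum_coeff hn.pos]
      simp [t, hn.neg_one_pow, h0, h1]
  refine ⟨t, .of_coeff hn fun k hk => ?_⟩
  have hP : P (k + 1) = P k + F.coeff k := Finset.sum_range_succ _ _
  rw [ht k hk.le, ht (k + 1) hk, hP]
  have hk : ((-1 : ℤ) ^ k) * (-1) ^ k = 1 := by rw [← mul_pow]; simp
  rw [pow_succ]
  linear_combination (-2 * F.coeff k) * hk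

/-- A sign function taking the value `-1` at `0` and `1` encodes a polynomial, which is Reinhardt
as soon as it is divisible by the relevant cyclotomic polynomial. -/
theorem exists_encodes_of_eq_neg_one {n : ℕ} (hn : Odd n) {t : ZMod n → ℤˣ}
    (ht0 : t 0 = -1) (ht1 : t 1 = -1) :
    ∃ F : Polynomial ℤ, Encodes n t F ∧ F.degree < n ∧
      (cyclotomic (2 * n) ℤ ∣ F → IsReinhardt n F) := by
  classical
  let s (k : ℕ) : ℤˣ := (-1) ^ k * t k
  have hs (k : ℕ) : s k = 1 ∨ s k = -1 := Int.units_eq_one_or _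
  have hs0 : s 0 = -1 := by simp [s, ht0]
  have hs1 : s 1 = 1 := by simp [s, ht1]
  have hsn : s n = 1 := by simp [s, ht0, hn.neg_one_pow]
  let c (k : ℕ) : ℤ := if s (k + 1) = s k then 0 else s (k + 1)
  have hc (k : ℕ) : 2 * c k = s (k + 1) - s k := by
    rcases hs k with h | h <;> rcases hs (k + 1) with h' | h' <;> simp [c, h, h']
  have hcne (k : ℕ) (h : c k ≠ 0) : s (k + 1) = - s k ∧ c k = s (k + 1) := by
    rcases hs k with h | h <;> rcases hs (k + 1) with h' | h' <;> simp_all [c]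
  have hczero (k : ℕ) (h : c k = 0) : s (k + 1) = s k := by
    have := hc k
    exact Units.ext (by omega)
  have hconst (i d : ℕ) (h : ∀ k, i < k → k < i + 1 + d → c k = 0) : s (i + 1 + d) = s (i + 1) := by
    induction d with
    | zero => rfl
    | succ d ih =>
      rw [← ih fun k h1 h2 => h k h1 (by omega), ← add_assoc]
      exact hczero _ (h _ (by omega) (by omega))
  let F : Polynomial ℤ := ∑ k ∈ Finset.range n, Polynomial.monomial k (c k)
  have hcoeff (k : ℕ) : F.coeff k = if k < n then c k else 0 := by
    simp [F, Polynomial.coeff_monomial]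
  have hlt {k : ℕ} (h : F.coeff k ≠ 0) : k < n := by
    by_contra hk
    exact h (by rw [hcoeff, if_neg hk])
  have hFc {k : ℕ} (h : k < n) : F.coeff k = c k := by rw [hcoeff, if_pos h]
  have h0 : F.coeff 0 = 1 := by
    rw [hFc hn.pos]
    simp [c, hs0, hs1]
  have hdeg : F.degree < n := (Polynomial.degree_lt_iff_coeff_zero _ _).2 fun k hk => by
    rw [hcoeff, if_neg (by omega)]
  have hpm (k : ℕ) : F.coeff k = -1 ∨ F.coeff k = 0 ∨ F.coeff k = 1 := by
    rw [hcoeff]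
    split_ifs
    · rcases hs k with h | h <;> rcases hs (k + 1) with h' | h' <;> simp [c, h, h']
    · exact Or.inr (Or.inl rfl)
  refine ⟨F, .of_coeff hn fun k hk => ?_, hdeg, fun hdvd => ⟨h0, hdeg, hpm, ?_, ?_, ?_, ?_, hdvd⟩⟩
  · rw [hFc hk, hc]
    simp only [s, Units.val_mul, Units.val_pow_eq_pow_val, Units.val_neg, Units.val_one]
    ring
  · intro i j hij hi hj hz
    have hi' := hlt hi
    have hj' := hlt hj
    rw [hFc hi'] at hi ⊢
    rw [hFc hj'] at hj ⊢
    obtain ⟨d, rfl⟩ : ∃ d, j = i + 1 + d := ⟨j - (i + 1), by omega⟩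
    have := hconst i d fun k h1 h2 => by rw [← hFc (by omega)]; exact hz k h1 h2
    rw [(hcne _ hi).2, (hcne _ hj).2, (hcne _ hj).1, this]
    simp
  · intro i hi hz
    rcases i.eq_zero_or_pos with rfl | hpos
    · exact h0
    · exact absurd (hz 0 hpos) (by rw [h0]; decide)
  · intro i hi hz
    have hi' := hlt hi
    rw [hFc hi'] at hi ⊢
    obtain ⟨d, hd⟩ : ∃ d, n = i + 1 + d := ⟨n - (i + 1), by omega⟩
    have := hconst i d fun k h1 h2 => by rw [← hFc (by omega)]; exact hz k h1
    rw [← hd, hsn] at this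
    rw [(hcne _ hi).2, ← this]
    rfl
  · have hsum : ∑ k ∈ Finset.range n, F.coeff k = 1 := by
      have : 2 * ∑ k ∈ Finset.range n, F.coeff k = 2 := by
        rw [Finset.sum_congr rfl fun k hk => hFc (Finset.mem_range.1 hk), Finset.mul_sum,
          Finset.sum_congr rfl fun k _ => hc k, Finset.sum_range_sub (fun k => (s k : ℤ)), hsn, hs0]
        rfl
      omega
    have hsub : F.support ⊆ Finset.range n := fun k hk =>
      Finset.mem_range.2 (hlt (Polynomial.mem_support_iff.1 hk))
    rw [← Finset.sum_subset hsub fun k _ hk => Polynomial.notMem_support_iff.1 hk] at hsum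
    have hcard : ((F.support.card : ℤ) : ZMod 2) = ((1 : ℤ) : ZMod 2) := by
      rw [← hsum, Int.cast_sum, Int.cast_natCast, Finset.card_eq_sum_ones, Nat.cast_sum]
      refine Finset.sum_congr rfl fun k hk => ?_
      rcases hpm k with h | h | h
      · rw [h]; rfl
      · exact absurd h (Polynomial.mem_support_iff.1 hk)
      · rw [h]; rfl
    rw [← ZMod.natCast_eq_one_iff_odd]
    exact_mod_cast hcard

theorem ZMod.sum_val_eq_sum_range {n : ℕ} [NeZero n] {M : Type*} [AddCommMonoid M] (g : ℕ → M) :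
    ∑ x : ZMod n, g x.val = ∑ k ∈ Finset.range n, g k := by
  obtain ⟨m, rfl⟩ := Nat.exists_eq_succ_of_ne_zero (NeZero.ne n)
  exact Fin.sum_univ_eq_sum_range g _

/-- The value at `ξ` of the polynomial whose coefficients are the values of `f`. -/
noncomputable def charSum {n : ℕ} [NeZero n] (f : ZMod n → ℤ) (ξ : ℂ) : ℂ :=
  ∑ x, (f x : ℂ) * ξ ^ x.val

section charSum

variable {n : ℕ} [NeZero n] {ξ : ℂ}

theorem charSum_eq_sum_range (f : ZMod n → ℤ) (ξ : ℂ) :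
    charSum f ξ = ∑ k ∈ Finset.range n, (f k : ℂ) * ξ ^ k := by
  rw [← ZMod.sum_val_eq_sum_range, charSum]
  simp

theorem charSum_eq_aeval (f : ZMod n → ℤ) (ξ : ℂ) :
    charSum f ξ = aeval ξ (∑ k ∈ Finset.range n, monomial k (f k)) := by
  rw [charSum_eq_sum_range, map_sum]
  simp [aeval_monomial]

theorem pow_mul_charSum (hξ : ξ ^ n = 1) (f : ZMod n → ℤ) (c : ℕ) :
    ξ ^ c * charSum (fun x : ZMod n => f (x + c)) ξ = charSum f ξ := by
  rw [charSum, charSum, Finset.mul_sum,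
    ← Equiv.sum_comp (Equiv.addRight (c : ZMod n)) fun x => (f x : ℂ) * ξ ^ x.val]
  refine Finset.sum_congr rfl fun x _ => ?_
  have h : ξ ^ (x + (c : ZMod n)).val = ξ ^ x.val * ξ ^ c := by
    rw [← pow_add, ZMod.val_add, ZMod.val_natCast, Nat.add_mod_mod, ← pow_eq_pow_mod _ hξ]
  rw [Equiv.coe_addRight, h]
  ring

theorem eq_zero_of_charSum_eq_zero (f : ZMod n → ℤ)
    (h : ∀ ξ : ℂ, ξ ^ n = 1 → charSum f ξ = 0) (x : ZMod n) : f x = 0 := by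
  have hn : 0 < n := NeZero.pos n
  have hP : (∑ k ∈ Finset.range n, monomial k (f k : ℂ) : ℂ[X]) = 0 := by
    refine eq_zero_of_degree_lt_of_eval_finset_eq_zero (nthRootsFinset n (1 : ℂ)) ?_ fun ξ hξ => ?_
    · rw [(Complex.isPrimitiveRoot_exp n hn.ne').card_nthRootsFinset]
      refine (degree_lt_iff_coeff_zero _ _).2 fun k hk => ?_
      simp [coeff_monomial, not_lt.2 hk]
    · rw [← h ξ ((mem_nthRootsFinset hn _).1 hξ), charSum_eq_sum_range, eval_finsetSum]
      simp
  have := congrArg (fun P => P.coeff x.val) hP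
  simpa [coeff_monomial, x.val_lt] using this

theorem charSum_eq_zero_of_isPrimitiveRoot {f : ZMod n → ℤ} {η : ℂ} (hη : IsPrimitiveRoot η n)
    (hξ : IsPrimitiveRoot ξ n) (h : charSum f η = 0) : charSum f ξ = 0 := by
  rw [charSum_eq_aeval] at h ⊢
  have hn : 0 < n := NeZero.pos n
  refine (minpoly.isIntegrallyClosed_dvd_iff (hξ.isIntegral hn) _).2 ?_
  rw [← cyclotomic_eq_minpoly hξ hn, cyclotomic_eq_minpoly hη hn]
  exact minpoly.isIntegrallyClosed_dvd (hη.isIntegral hn) h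

theorem Encodes.cyclotomic_dvd_iff {t : ZMod n → ℤˣ} {F : Polynomial ℤ} (h : Encodes n t F)
    (hn : Odd n) (hdeg : F.degree < n) {η : ℂ} (hη : IsPrimitiveRoot η n) :
    cyclotomic (2 * n) ℤ ∣ F ↔ charSum (fun x => (t x : ℤ)) η = 0 := by
  have hpos : 0 < n := hn.pos
  have hζ : IsPrimitiveRoot (-η) (2 * n) := by
    convert! IsPrimitiveRoot.orderOf (-η)
    rw [neg_eq_neg_one_mul, (Commute.all _ _).orderOf_mul_eq_mul_orderOf_of_coprime]
    · simp [hη.eq_orderOf]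
    · simp [← hη.eq_orderOf, hn]
  rw [cyclotomic_eq_minpoly hζ (by omega),
    ← minpoly.isIntegrallyClosed_dvd_iff (hζ.isIntegral (by omega))]
  have hη0 : η ≠ 0 := hη.ne_zero hpos.ne'
  have hη1 : η + 1 ≠ 0 := by
    intro h1
    have h2 := hη.pow_eq_one
    rw [eq_neg_of_add_eq_zero_left h1, hn.neg_one_pow] at h2
    norm_num at h2
  have hF : aeval (-η) F = ∑ k ∈ Finset.range n, (F.coeff k : ℂ) * (-η) ^ k := by
    rcases eq_or_ne F 0 with rfl | hF0
    · simp
    · rw [aeval_eq_sum_range' ((natDegree_lt_iff_degree_lt hF0).2 hdeg)]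
      simp
  have hval : η * (2 * aeval (-η) F) = -(η + 1) * charSum (fun x => (t x : ℤ)) η := by
    have h2 : 2 * aeval (-η) F =
        -(charSum (fun x => (t x : ℤ)) η + charSum (fun x : ZMod n => (t (x + (1 : ℕ)) : ℤ)) η) := by
      rw [hF, charSum_eq_sum_range, charSum_eq_sum_range, Finset.mul_sum,
        ← Finset.sum_add_distrib, ← Finset.sum_neg_distrib]
      refine Finset.sum_congr rfl fun k hk => ?_
      have hc := congrArg (Int.cast : ℤ → ℂ) (h.coeff (Finset.mem_range.1 hk))
      push_cast at hc ⊢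
      have hsq : (-1 : ℂ) ^ k * (-1) ^ k = 1 := by rw [← mul_pow]; simp
      rw [← mul_assoc, hc, neg_pow η k, pow_succ]
      linear_combination (-((t k : ℤ) : ℂ) - ((t (k + 1) : ℤ) : ℂ)) * η ^ k * hsq
    have h3 := pow_mul_charSum hη.pow_eq_one (fun x => (t x : ℤ)) 1
    rw [h2]
    linear_combination -h3
  constructor
  · intro h0
    rw [h0, mul_zero, mul_zero, eq_comm] at hval
    exact (mul_eq_zero.1 hval).resolve_left (neg_ne_zero.2 hη1)
  · intro h0
    rw [h0, mul_zero] at hval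
    simpa [hη0] using hval

theorem charSum_eq_zero_of_periodic {η : ℂ} (hη : IsPrimitiveRoot η n) {m : ℕ} (hm : 0 < m)
    (hmn : m < n) {f : ZMod n → ℤ} (hf : ∀ x, f (x + m) = f x) : charSum f η = 0 := by
  have h := pow_mul_charSum hη.pow_eq_one f m
  simp only [hf] at h
  have hne := hη.pow_ne_one_of_pos_of_lt hm.ne' hmn
  exact (mul_eq_zero.1 (show (η ^ m - 1) * charSum f η = 0 by linear_combination h)).resolve_left
    (sub_ne_zero.2 hne)

end charSum

section twoPrimes

variable {p q : ℕ}

theorem add_add_eq_add_of_charSum_eq_zero [NeZero (p * q)] (hp : p.Prime) (hq : q.Prime)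
    {f : ZMod (p * q) → ℤ} {η : ℂ} (hη : IsPrimitiveRoot η (p * q)) (h : charSum f η = 0)
    (x : ZMod (p * q)) : f x + f (x + p + q) = f (x + p) + f (x + q) := by
  have key := eq_zero_of_charSum_eq_zero
    (fun x : ZMod (p * q) => f x + f (x + p + q) - f (x + p) - f (x + q)) (fun ξ hξ => ?_) x
  · linarith
  have hsum : ξ ^ (p + q) *
      charSum (fun x : ZMod (p * q) => f x + f (x + p + q) - f (x + p) - f (x + q)) ξ =
      (ξ ^ p - 1) * (ξ ^ q - 1) * charSum f ξ := by
    have h1 := pow_mul_charSum hξ f p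
    have h2 := pow_mul_charSum hξ f q
    have h3 := pow_mul_charSum hξ f (p + q)
    have h4 : charSum (fun x : ZMod (p * q) => f x + f (x + p + q) - f (x + p) - f (x + q)) ξ =
        charSum f ξ + charSum (fun x : ZMod (p * q) => f (x + (p + q : ℕ))) ξ
          - charSum (fun x : ZMod (p * q) => f (x + p)) ξ
          - charSum (fun x : ZMod (p * q) => f (x + q)) ξ := by
      simp only [charSum, ← Finset.sum_add_distrib, ← Finset.sum_sub_distrib]
      refine Finset.sum_congr rfl fun x _ => ?_
      push_cast
      rw [← add_assoc]
      ring
    rw [h4]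
    linear_combination h3 - ξ ^ q * h1 - ξ ^ p * h2
  have hzero : (ξ ^ p - 1) * (ξ ^ q - 1) * charSum f ξ = 0 := by
    by_cases hp1 : ξ ^ p = 1
    · simp [hp1]
    by_cases hq1 : ξ ^ q = 1
    · simp [hq1]
    have hord : orderOf ξ = p * q := by
      obtain ⟨a, b, ha, hb, hab⟩ := Nat.dvd_mul.1 (orderOf_dvd_of_pow_eq_one hξ)
      rcases (Nat.dvd_prime hp).1 ha with rfl | rfl
      · exact absurd (orderOf_dvd_iff_pow_eq_one.1 (by rw [← hab, one_mul]; exact hb)) hq1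
      · rcases (Nat.dvd_prime hq).1 hb with rfl | rfl
        · exact absurd (orderOf_dvd_iff_pow_eq_one.1 (by rw [← hab, mul_one])) hp1
        · exact hab.symm
    rw [charSum_eq_zero_of_isPrimitiveRoot hη (hord ▸ IsPrimitiveRoot.orderOf ξ) h, mul_zero]
  rw [hzero] at hsum
  refine (mul_eq_zero.1 hsum).resolve_left (pow_ne_zero _ fun h0 => ?_)
  rw [h0, zero_pow (NeZero.ne _)] at hξ
  exact zero_ne_one hξ

/-- A sign function on `ℤ/pqℤ` that is a sum of a `p`-periodic and a `q`-periodic function is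
itself `p`-periodic or `q`-periodic. -/
theorem periodic_or_periodic_of_add_add_eq_add [NeZero (p * q)] (hpq : p.Coprime q)
    {t : ZMod (p * q) → ℤˣ}
    (h : ∀ x, (t x : ℤ) + t (x + p + q) = t (x + p) + t (x + q)) :
    (∀ x, t (x + p) = t x) ∨ (∀ x, t (x + q) = t x) := by
  have hval (x) : (t x : ℤ) = 1 ∨ (t x : ℤ) = -1 := by
    rcases Int.units_eq_one_or (t x) with h | h <;> simp [h]
  have hp' (x) (m : ℕ) : (t (x + m * q + p) : ℤ) - t (x + m * q) = t (x + p) - t x := by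
    induction m with
    | zero => simp
    | succ m ih =>
      have := h (x + m * q)
      push_cast
      rw [show x + ((m : ZMod (p * q)) + 1) * q + p = x + m * q + p + q by ring,
        show x + ((m : ZMod (p * q)) + 1) * q = x + m * q + q by ring]
      linarith
  have hq' (x) (m : ℕ) : (t (x + m * p + q) : ℤ) - t (x + m * p) = t (x + q) - t x := by
    induction m with
    | zero => simp
    | succ m ih =>
      have := h (x + m * p)
      push_cast
      rw [show x + ((m : ZMod (p * q)) + 1) * p + q = x + m * p + p + q by ring,
        show x + ((m : ZMod (p * q)) + 1) * p = x + m * p + p by ring]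
      linarith
  have hmeet (x y : ZMod (p * q)) : ∃ i j : ℕ, x + i * q = y + j * p := by
    have hbez : (p : ZMod (p * q)) * ((p.gcdA q : ℤ) : ZMod (p * q)) +
        q * ((p.gcdB q : ℤ) : ZMod (p * q)) = 1 := by
      have := congrArg (Int.cast : ℤ → ZMod (p * q)) (Nat.gcd_eq_gcd_ab p q)
      rw [hpq] at this
      push_cast at this
      exact this.symm
    obtain ⟨i, hi⟩ := ZMod.natCast_zmod_surjective ((y - x) * ((p.gcdB q : ℤ) : ZMod (p * q)))
    obtain ⟨j, hj⟩ := ZMod.natCast_zmod_surjective (-((y - x) * ((p.gcdA q : ℤ) : ZMod (p * q))))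
    refine ⟨i, j, ?_⟩
    rw [hi, hj]
    linear_combination (y - x) * hbez
  by_contra! hcon
  obtain ⟨⟨x, hx⟩, y, hy⟩ := hcon
  have hx' : (t (x + p) : ℤ) ≠ t x := fun hh => hx (Units.ext hh)
  have hy' : (t (y + q) : ℤ) ≠ t y := fun hh => hy (Units.ext hh)
  obtain ⟨i, j, hij⟩ := hmeet x y
  obtain ⟨i', j', hij'⟩ := hmeet (x + p) y
  have e1 := hp' x i
  have e2 := hq' y j
  have e3 := hp' x i'
  have e4 := hq' y j'
  rw [← hij] at e2
  rw [← hij', show x + p + i' * q = x + i' * q + p by ring] at e4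
  have v1 := hval (x + i * q)
  have v2 := hval (x + i * q + p)
  have v3 := hval (x + i' * q)
  have v4 := hval (x + i' * q + p)
  have v5 := hval (x + i * q + q)
  have v6 := hval (x + i' * q + p + q)
  omega

end twoPrimes

theorem exists_comp_castHom_of_periodic {n m : ℕ} [NeZero n] (h : m ∣ n) {t : ZMod n → ℤˣ}
    (ht : ∀ x, t (x + m) = t x) : ∃ t' : ZMod m → ℤˣ, t = t' ∘ ZMod.castHom h (ZMod m) := by
  have hper (x : ZMod n) (k : ℕ) : t (x + k * m) = t x := by
    induction k with
    | zero => simp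
    | succ k ih => rw [← ih, ← ht (x + k * m)]; congr 1; push_cast; ring
  refine ⟨fun y => t (y.val : ℕ), funext fun x => ?_⟩
  obtain ⟨k, rfl⟩ := ZMod.natCast_zmod_surjective x
  rw [Function.comp_apply, map_natCast, ZMod.val_natCast, ← hper ((k % m : ℕ) : ZMod n) (k / m),
    ← Nat.cast_mul, ← Nat.cast_add, Nat.mod_add_div']

/-- The bracelets encoding Reinhardt polynomials for `pq` are those pulled back from `ℤ/pℤ` or
from `ℤ/qℤ`. -/
theorem exists_isReinhardt_encodes_iff {p q : ℕ} (hp : p.Prime) (hq : q.Prime) (hop : Odd p)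
    (hoq : Odd q) (hpq : p ≠ q) (B : SignBracelet (p * q)) :
    (∃ F t, IsReinhardt (p * q) F ∧ Encodes (p * q) t F ∧ SignBracelet.mk t = B) ↔
      B ∈ Set.range (SignBracelet.lift (dvd_mul_right p q)) ∪
        Set.range (SignBracelet.lift (dvd_mul_left q p)) := by
  have hn : Odd (p * q) := hop.mul hoq
  have : NeZero (p * q) := ⟨hn.pos.ne'⟩
  have hη := Complex.isPrimitiveRoot_exp (p * q) hn.pos.ne'
  constructor
  · rintro ⟨F, t, hF, ht, rfl⟩
    have h0 := (ht.cyclotomic_dvd_iff hn hF.2.1 hη).1 hF.2.2.2.2.2.2.2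
    rcases periodic_or_periodic_of_add_add_eq_add ((Nat.coprime_primes hp hq).2 hpq)
      (add_add_eq_add_of_charSum_eq_zero hp hq hη h0) with h | h
    · obtain ⟨t', rfl⟩ := exists_comp_castHom_of_periodic (dvd_mul_right p q) h
      exact Or.inl ⟨_, SignBracelet.lift_mk _ t'⟩
    · obtain ⟨t', rfl⟩ := exists_comp_castHom_of_periodic (dvd_mul_left q p) h
      exact Or.inr ⟨_, SignBracelet.lift_mk _ t'⟩
  · have key (m : ℕ) (hm : m ∣ p * q) (hm0 : 0 < m) (hmn : m < p * q) (t : ZMod m → ℤˣ) :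
        ∃ F t', IsReinhardt (p * q) F ∧ Encodes (p * q) t' F ∧
          SignBracelet.mk t' = SignBracelet.lift hm (SignBracelet.mk t) := by
      set s := t ∘ ZMod.castHom hm (ZMod m) with hs
      have hper (x) : s (x + m) = s x := by
        simp only [hs, Function.comp_apply, map_add, map_natCast, ZMod.natCast_self, add_zero]
      obtain ⟨k, hk⟩ : ∃ k, s (k + 1) = s k := by
        by_contra! hne
        have halt (i : ℕ) : s i = (-1) ^ i * s 0 := by
          induction i with
          | zero => simp
          | succ i ih =>
            rw [Nat.cast_add, Nat.cast_one, Int.units_ne_iff_eq_neg.1 (hne i), ih, pow_succ]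
            simp
        have := halt (p * q)
        rw [ZMod.natCast_self, hn.neg_one_pow] at this
        simp at this
      let t' (x : ZMod (p * q)) : ℤˣ := -s k * s (x + k)
      have hmk : SignBracelet.mk s = SignBracelet.mk t' :=
        SignBracelet.mk_eq_mk_iff.2 ⟨k, -s k, Or.inl fun _ => rfl⟩
      obtain ⟨F, hF, hdeg, hR⟩ := exists_encodes_of_eq_neg_one hn (t := t')
        (by simp [t']) (by simp [t', add_comm 1 k, hk])
      refine ⟨F, t', hR ((hF.cyclotomic_dvd_iff hn hdeg hη).2 ?_), hF, hmk.symm⟩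
      refine charSum_eq_zero_of_periodic hη hm0 hmn fun x => ?_
      simp only [t', add_right_comm x (m : ZMod (p * q)) k, hper]
    have hp2 := hp.one_lt
    have hq2 := hq.one_lt
    rintro (⟨b, rfl⟩ | ⟨b, rfl⟩) <;> obtain ⟨t, rfl⟩ := SignBracelet.mk_surjective b
    · exact key p _ hp.pos (by nlinarith) t
    · exact key q _ hq.pos (by nlinarith) t

theorem En_eq_ncard {p q : ℕ} (hp : p.Prime) (hq : q.Prime) (hop : Odd p)
    (hoq : Odd q) (hpq : p ≠ q) :
    En (p * q) = (Set.range (SignBracelet.lift (dvd_mul_right p q)) ∪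
        Set.range (SignBracelet.lift (dvd_mul_left q p))).ncard := by
  have hn : Odd (p * q) := hop.mul hoq
  choose t ht using fun F : {F : Polynomial ℤ // IsReinhardt (p * q) F} => F.2.exists_encodes hn
  let Ψ : Quot (fun F F' : {F : Polynomial ℤ // IsReinhardt (p * q) F} =>
      REquiv (p * q) F.1 F'.1) → SignBracelet (p * q) :=
    Quot.lift (fun F => SignBracelet.mk (t F)) fun F F' h => ((ht F).equiv_iff hn (ht F')).1 h
  have hinj : Function.Injective Ψ := by
    rintro ⟨F⟩ ⟨F'⟩ h
    exact Quot.sound (((ht F).equiv_iff hn (ht F')).2 h)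
  rw [En, ← Set.ncard_range_of_injective hinj]
  congr 1
  ext B
  rw [← exists_isReinhardt_encodes_iff hp hq hop hoq hpq B]
  constructor
  · rintro ⟨⟨F⟩, rfl⟩
    exact ⟨F, t F, F.2, ht F, rfl⟩
  · rintro ⟨F, s, hF, hs, rfl⟩
    exact ⟨Quot.mk _ ⟨F, hF⟩, congrArg SignBracelet.mk ((ht ⟨F, hF⟩).unique hn hs)⟩

/-- For `n = pq` with `p, q` distinct odd primes,
`E(n) = 2^{(p-3)/2} + (2^{p-1}+p-1)/(2p) + 2^{(q-3)/2} + (2^{q-1}+q-1)/(2q) - 1`,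
where both displayed fractions are integers. -/
theorem En_pq_formula (p q : ℕ) (hp : p.Prime) (hq : q.Prime) (hop : Odd p) (hoq : Odd q)
    (hpq : p ≠ q) :
    2 * p ∣ 2 ^ (p - 1) + p - 1 ∧ 2 * q ∣ 2 ^ (q - 1) + q - 1 ∧
    En (p * q) = 2 ^ ((p - 3) / 2) + (2 ^ (p - 1) + p - 1) / (2 * p)
      + 2 ^ ((q - 3) / 2) + (2 ^ (q - 1) + q - 1) / (2 * q) - 1 := by
  refine ⟨hp.two_mul_dvd_two_pow_add_sub_one hop, hq.two_mul_dvd_two_pow_add_sub_one hoq, ?_⟩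
  have : NeZero p := ⟨hp.ne_zero⟩
  have : NeZero q := ⟨hq.ne_zero⟩
  have h := SignBracelet.ncard_range_lift_union_range_lift ((Nat.coprime_primes hp hq).2 hpq)
  rw [← En_eq_ncard hp hq hop hoq hpq, SignBracelet.card_eq hp hop,
    SignBracelet.card_eq hq hoq] at h
  omega
end

section
/- Let p and q be distinct primes. Then there exist polynomials a, b ∈ ℤ[z] with deg a < q and deg b < p such that a(z)·Φ_p(z) + b(z)·Φ_q(z) = 1. -/
open Polynomial

theorem isCoprime_self_geom_sum {R : Type*} [CommRing R] (x : R) {m : ℕ} (hm : 0 < m) :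
    IsCoprime x (∑ i ∈ Finset.range m, x ^ i) := by
  obtain ⟨k, rfl⟩ := Nat.exists_eq_succ_of_ne_zero hm.ne'
  refine ⟨-∑ i ∈ Finset.range k, x ^ i, 1, ?_⟩
  rw [geom_sum_succ]
  ring

theorem Nat.Coprime.isCoprime_geom_sum {R : Type*} [CommRing R] (x : R) {m n : ℕ}
    (h : m.Coprime n) :
    IsCoprime (∑ i ∈ Finset.range m, x ^ i) (∑ i ∈ Finset.range n, x ^ i) := by
  induction hs : m + n using Nat.strong_induction_on generalizing m n with
  | _ s ih =>
    subst hs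
    wlog hmn : m ≤ n generalizing m n
    · exact (this h.symm (fun t ht => ih t (by omega)) (by omega)).symm
    rcases m.eq_zero_or_pos with rfl | hm
    · obtain rfl : n = 1 := by simpa using h
      simpa using isCoprime_one_right
    · obtain ⟨k, rfl⟩ := Nat.exists_eq_add_of_le hmn
      have hk : m.Coprime k := by simpa using h
      have hc := ((isCoprime_self_geom_sum x hm).symm.pow_right (n := m)).mul_right
        (ih (m + k) (by omega) hk rfl)
      rw [Finset.sum_range_add]
      simp only [pow_add, ← Finset.mul_sum]
      simpa [add_comm] using hc.add_mul_left_right 1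

/-- For distinct primes `p` and `q` there are `a, b ∈ ℤ[z]` with
`deg a < q`, `deg b < p`, and `a·Φ_p + b·Φ_q = 1`. -/
theorem cyclotomic_bezout (p q : ℕ) (hp : p.Prime) (hq : q.Prime) (hpq : p ≠ q) :
    ∃ a b : Polynomial ℤ, a.degree < (q : WithBot ℕ) ∧ b.degree < (p : WithBot ℕ) ∧
      a * cyclotomic p ℤ + b * cyclotomic q ℤ = 1 := by
  have hc : IsCoprime (cyclotomic p ℤ) (cyclotomic q ℤ) := by
    have := Fact.mk hp
    have := Fact.mk hq
    rw [cyclotomic_prime, cyclotomic_prime]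
    exact ((Nat.coprime_primes hp hq).2 hpq).isCoprime_geom_sum X
  obtain ⟨u, v, huv⟩ := hc
  have hmon := cyclotomic.monic q ℤ
  have hdp : (cyclotomic p ℤ).natDegree = p - 1 := by
    rw [natDegree_cyclotomic, Nat.totient_prime hp]
  have hdq : (cyclotomic q ℤ).natDegree = q - 1 := by
    rw [natDegree_cyclotomic, Nat.totient_prime hq]
  have hp2 := hp.two_le
  have hq2 := hq.two_le
  set a := u %ₘ cyclotomic q ℤ
  set b := v + u /ₘ cyclotomic q ℤ * cyclotomic p ℤ with hb
  have hab : a * cyclotomic p ℤ + b * cyclotomic q ℤ = 1 := by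
    rw [hb, ← huv]
    linear_combination cyclotomic p ℤ * modByMonic_add_div u (cyclotomic q ℤ)
  have hda : a.natDegree < q - 1 := by
    rw [← hdq]
    refine natDegree_modByMonic_lt u hmon fun h => ?_
    have := congrArg natDegree h
    rw [hdq, natDegree_one] at this
    omega
  have hdb : b.natDegree < p := by
    rcases eq_or_ne b 0 with h0 | h0
    · simp [h0, hp.pos]
    have h1 : (b * cyclotomic q ℤ).natDegree = b.natDegree + (q - 1) := by
      rw [natDegree_mul h0 hmon.ne_zero, hdq]
    have h2 : (1 - a * cyclotomic p ℤ).natDegree ≤ a.natDegree + (p - 1) := by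
      refine (natDegree_sub_le _ _).trans (max_le (by simp) ?_)
      exact natDegree_mul_le.trans_eq (by rw [hdp])
    rw [← eq_sub_of_add_eq' hab, h1] at h2
    omega
  exact ⟨a, b, degree_le_natDegree.trans_lt (by norm_cast; omega),
    degree_le_natDegree.trans_lt (by norm_cast), hab⟩
end
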